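/- Let n ≥ 4 and let B ∈ 𝒰^n. Suppose B contains e_{i₁} + ⋯ + e_{i_{n−2}} for every choice of n−2 distinct indices i₁,…,i_{n−2} ∈ {1,…,n} (i.e., every coordinate permutation of e_1 + ⋯ + e_{n−2}), but contains no coordinate permutation of e_1 + ⋯ + e_{n−1}. Then there exist δ ∈ (0,1), ζ ∈ (0,δ), and a set D of nonzero directions with D = −D and |D| ≤ 2^n − 2 that illuminates B, where each d ∈ D has exactly one coordinate equal to ±1 (at index n−2, n−1, or n), every other coordinate of absolute value δ or ζ, and at most one coordinate of absolute value ζ. In particular 𝕀(B) ≤ 2^n − 2. -/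

import Mathlib

open Set

/-- A convex body in `ℝ^n`: a compact convex set with nonempty interior. -/
def IsConvexBody {n : ℕ} (K : Set (Fin n → ℝ)) : Prop :=
  Convex ℝ K ∧ IsCompact K ∧ (interior K).Nonempty

/-- `K` is 1-unconditional: closed under sign changes of the coordinates. -/
def Unconditional {n : ℕ} (K : Set (Fin n → ℝ)) : Prop :=
  ∀ x ∈ K, ∀ ε : Fin n → ℝ, (∀ i, ε i = 1 ∨ ε i = -1) → (fun i => ε i * x i) ∈ K

/-- The direction `d` illuminates the (boundary) point `x` of `K`. -/
def Illuminates {n : ℕ} (K : Set (Fin n → ℝ)) (d x : Fin n → ℝ) : Prop :=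
  ∃ ε : ℝ, 0 < ε ∧ x + ε • d ∈ interior K

/-- The set of directions `D` illuminates every boundary point of `K`. -/
def IlluminatesSet {n : ℕ} (K : Set (Fin n → ℝ)) (D : Set (Fin n → ℝ)) : Prop :=
  ∀ x ∈ frontier K, ∃ d ∈ D, Illuminates K d x

/-- The illumination number: smallest cardinality of a set of nonzero directions
illuminating `K`. -/
noncomputable def illumNumber {n : ℕ} (K : Set (Fin n → ℝ)) : ℕ :=
  sInf {m | ∃ D : Finset (Fin n → ℝ), D.card = m ∧ (∀ d ∈ D, d ≠ 0) ∧
    IlluminatesSet K ↑D}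

/-- A parallelepiped: an affine image of the cube `[-1,1]^n`. -/
def IsParallelepiped {n : ℕ} (K : Set (Fin n → ℝ)) : Prop :=
  ∃ T : (Fin n → ℝ) ≃ᵃ[ℝ] (Fin n → ℝ),
    K = T '' (Set.Icc (fun _ => (-1 : ℝ)) (fun _ => 1))

/-- The standard basis vector `e i`. -/
def stdB {n : ℕ} (i : Fin n) : Fin n → ℝ := Pi.single i 1

/-- The class `𝒰^n`: 1-unconditional convex bodies all of whose standard basis
vectors lie on the boundary. -/
def memU {n : ℕ} (K : Set (Fin n → ℝ)) : Prop :=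
  IsConvexBody K ∧ Unconditional K ∧ ∀ i : Fin n, stdB i ∈ frontier K

/-- A 1-unconditional body is cubelike if all its extreme points have all
coordinates nonzero. -/
def Cubelike {n : ℕ} (K : Set (Fin n → ℝ)) : Prop :=
  ∀ x ∈ Set.extremePoints ℝ K, ∀ i, x i ≠ 0

/-- The all-ones vector `𝟙`. -/
def allOnes {n : ℕ} : Fin n → ℝ := fun _ => 1

lemma solid_mem {n : ℕ} {B : Set (Fin n → ℝ)} (hc : Convex ℝ B) (hu : Unconditional B)
    {x y : Fin n → ℝ} (hx : x ∈ B) (h : ∀ i, |y i| ≤ |x i|) : y ∈ B := by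
  have h1 : y ∈ Set.pi Set.univ (fun i => convexHull ℝ ({-|x i|, |x i|} : Set ℝ)) := by
    intro i _
    show y i ∈ convexHull ℝ ({-|x i|, |x i|} : Set ℝ)
    rw [convexHull_pair, segment_eq_Icc (by linarith [abs_nonneg (x i)])]
    exact abs_le.mp (h i)
  rw [← convexHull_pi] at h1
  refine convexHull_min ?_ hc h1
  intro v hv
  have hv' : ∀ i, ∃ e : ℝ, (e = 1 ∨ e = -1) ∧ v i = e * x i := by
    intro i
    have := hv i (Set.mem_univ i)
    simp only [Set.mem_insert_iff, Set.mem_singleton_iff] at this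
    rcases abs_choice (x i) with h2 | h2 <;> rw [h2] at this <;> rcases this with h3 | h3
    · exact ⟨-1, Or.inr rfl, by linarith⟩
    · exact ⟨1, Or.inl rfl, by linarith⟩
    · exact ⟨1, Or.inl rfl, by linarith⟩
    · exact ⟨-1, Or.inr rfl, by linarith⟩
  choose e he hve using hv'
  have := hu x hx e he
  convert this using 1
  funext i
  exact hve i

lemma mem_int {n : ℕ} {B : Set (Fin n → ℝ)} (hc : Convex ℝ B) (hu : Unconditional B)
    {p y : Fin n → ℝ} (hy : y ∈ B) (h : ∀ i, |p i| < y i) : p ∈ interior B := by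
  rw [mem_interior]
  refine ⟨{q | ∀ i, |q i| < y i}, ?_, ?_, h⟩
  · intro q hq
    exact solid_mem hc hu hy (fun i => (le_of_lt (hq i)).trans (le_abs_self _))
  · simp only [Set.ofPred_forall]
    exact isOpen_iInter_of_finite (fun i => isOpen_lt (by fun_prop) continuous_const)

lemma illum_of {n : ℕ} {B : Set (Fin n → ℝ)} (hc : Convex ℝ B) (hu : Unconditional B)
    {x z d : Fin n → ℝ} {τ : ℝ} (hτ : 0 < τ) (hx : x ∈ B) (hz : z ∈ B)
    (h : ∀ i, (x i * d i < 0 ∧ τ * (|x i| - z i) < |d i|) ∨ |d i| < τ * (z i - |x i|)) :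
    Illuminates B d x := by
  have hax : (fun i => |x i|) ∈ B := solid_mem hc hu hx (fun i => by simp)
  have e1 : ∀ᶠ ε : ℝ in nhdsWithin 0 (Set.Ioi 0), ∀ i, x i ≠ 0 → ε * |d i| < |x i| := by
    rw [Filter.eventually_all]
    intro i
    by_cases hxi : x i = 0
    · simp [hxi]
    · have : Filter.Tendsto (fun ε : ℝ => ε * |d i|) (nhdsWithin 0 (Set.Ioi 0)) (nhds 0) := by
        have : Filter.Tendsto (fun ε : ℝ => ε * |d i|) (nhds 0) (nhds (0 * |d i|)) :=
          (continuous_id.mul continuous_const).tendsto 0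
        rw [zero_mul] at this
        exact this.mono_left nhdsWithin_le_nhds
      filter_upwards [this.eventually (gt_mem_nhds (abs_pos.mpr hxi))] with ε hε _
      exact hε
  have e2 : ∀ᶠ ε : ℝ in nhdsWithin 0 (Set.Ioi 0), ε * τ < 1 := by
    have : Filter.Tendsto (fun ε : ℝ => ε * τ) (nhds 0) (nhds (0 * τ)) :=
      (continuous_id.mul continuous_const).tendsto 0
    rw [zero_mul] at this
    exact (this.mono_left nhdsWithin_le_nhds).eventually (gt_mem_nhds one_pos)
  obtain ⟨ε, ⟨h1, h2⟩, h3⟩ := ((e1.and e2).and self_mem_nhdsWithin).exists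
  have h3 : 0 < ε := h3
  refine ⟨ε, h3, ?_⟩
  have hy := hc hax hz (show 0 ≤ 1 - ε * τ by linarith) (show 0 ≤ ε * τ by positivity) (by ring)
  refine mem_int hc hu hy (fun i => ?_)
  simp only [Pi.add_apply, Pi.smul_apply, smul_eq_mul]
  rcases h i with ⟨h4, h5⟩ | h5
  · have hne : x i ≠ 0 := by rintro h0; simp [h0] at h4
    have h6 := h1 i hne
    have h7 := mul_lt_mul_of_pos_left h5 h3
    rcases mul_neg_iff.mp h4 with ⟨ha, hb⟩ | ⟨ha, hb⟩
    · rw [abs_of_pos ha, abs_of_neg hb] at *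
      rw [abs_lt]; constructor <;> nlinarith
    · rw [abs_of_neg ha, abs_of_pos hb] at *
      rw [abs_lt]; constructor <;> nlinarith
  · have h7 := mul_lt_mul_of_pos_left h5 h3
    have h8 := abs_add_le (x i) (ε * d i)
    rw [abs_mul, abs_of_pos h3] at h8
    nlinarith

lemma conv3 {n : ℕ} {B : Set (Fin n → ℝ)} (hc : Convex ℝ B) {u v w : Fin n → ℝ} {a b c : ℝ}
    (hu : u ∈ B) (hv : v ∈ B) (hw : w ∈ B) (ha : 0 ≤ a) (hb : 0 ≤ b) (hcc : 0 ≤ c)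
    (h : a + b + c = 1) : a • u + b • v + c • w ∈ B := by
  have := hc.sum_mem (t := Finset.univ) (w := ![a, b, c]) (z := ![u, v, w])
    (by intro i _; fin_cases i <;> simpa) (by simpa [Fin.sum_univ_three] using h)
    (by intro i _; fin_cases i <;> simpa)
  simpa [Fin.sum_univ_three] using this

lemma stdB_apply' {n : ℕ} (i j : Fin n) : stdB i j = if j = i then (1 : ℝ) else 0 := by
  simp [stdB, Pi.single_apply]

/-- index of the coordinate of absolute value one -/
def kidx {n : ℕ} (a b c : Fin n) (σ : Fin n → Bool) : Fin n :=
  if σ a = σ b then a else if σ a = σ c then c else b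

def lone {n : ℕ} (σ : Fin n → Bool) (i : Fin n) : Prop := ∀ j, j ≠ i → σ j ≠ σ i

open Classical in
noncomputable def mag {n : ℕ} (a b c : Fin n) (δ ζ : ℝ) (σ : Fin n → Bool) (i : Fin n) : ℝ :=
  if i = kidx a b c σ then 1 else if lone σ i then ζ else δ

noncomputable def dirv {n : ℕ} (a b c : Fin n) (δ ζ : ℝ) (σ : Fin n → Bool) : Fin n → ℝ :=
  fun i => (if σ i then 1 else -1) * mag a b c δ ζ σ i

def nonconst {n : ℕ} (σ : Fin n → Bool) : Prop := ∃ p q, σ p ≠ σ q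

lemma kidx_not_lone {n : ℕ} {a b c : Fin n} (hab : a ≠ b) (hac : a ≠ c) (hbc : b ≠ c)
    (σ : Fin n → Bool) : ∃ j, j ≠ kidx a b c σ ∧ σ j = σ (kidx a b c σ) := by
  unfold kidx
  split_ifs with h1 h2
  · exact ⟨b, hab.symm, h1.symm⟩
  · exact ⟨a, hac, h2⟩
  · refine ⟨c, hbc.symm, ?_⟩
    revert h1 h2
    cases σ a <;> cases σ b <;> cases σ c <;> simp

lemma lone_unique {n : ℕ} (hn : 4 ≤ n) {σ : Fin n → Bool} {i j : Fin n} (hi : lone σ i)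
    (hj : lone σ j) : i = j := by
  by_contra hne
  obtain ⟨l, hl⟩ : ∃ l, l ∉ ({i, j} : Finset (Fin n)) := by
    by_contra hcon
    push Not at hcon
    have h1 : (Finset.univ : Finset (Fin n)) ⊆ {i, j} := fun l _ => hcon l
    have h2 := Finset.card_le_card h1
    have h3 := Finset.card_le_two (a := i) (b := j)
    rw [Finset.card_univ, Fintype.card_fin] at h2
    omega
  simp only [Finset.mem_insert, Finset.mem_singleton, not_or] at hl
  have h1 := hi l hl.1
  have h2 := hj l hl.2
  have h3 := hj i hne
  revert h1 h2 h3
  cases σ l <;> cases σ i <;> cases σ j <;> simp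

lemma flip_one {n : ℕ} {a b c : Fin n} (hab : a ≠ b) (hac : a ≠ c) (hbc : b ≠ c)
    (σ : Fin n → Bool) (i : Fin n) : ∃ ρ : Fin n → Bool, (∀ j, j ≠ i → ρ j = σ j) ∧
      nonconst ρ ∧ kidx a b c ρ ≠ i := by
  obtain ⟨w, hwi, hw⟩ : ∃ w, w ≠ i ∧ (w = a ∨ w = b) := by
    by_cases h : a = i
    · exact ⟨b, h ▸ hab.symm, Or.inr rfl⟩
    · exact ⟨a, h, Or.inl rfl⟩
  by_cases h : ∃ ρ : Fin n → Bool, (∀ j, j ≠ i → ρ j = σ j) ∧ nonconst ρ ∧ kidx a b c ρ = i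
  · obtain ⟨ρ, h1, h2, h3⟩ := h
    refine ⟨Function.update ρ i (!ρ i), fun j hj => by simp [hj, h1], ?_, ?_⟩
    · obtain ⟨j, hj, hj'⟩ := kidx_not_lone hab hac hbc ρ
      rw [h3] at hj hj'
      exact ⟨i, j, by simp [hj, hj']⟩
    · subst h3
      unfold kidx
      by_cases e1 : ρ a = ρ b
      · simp [e1, hab, hab.symm, hac, hac.symm, hbc, hbc.symm]
        split_ifs <;> simp_all [eq_comm]
      · by_cases e2 : ρ a = ρ c
        · simp [e1, e2, hab, hab.symm, hac, hac.symm, hbc, hbc.symm]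
          split_ifs <;> simp_all [eq_comm]
        · have : ρ a = !ρ b := by revert e1; cases ρ a <;> cases ρ b <;> simp
          have hkb : (if ρ a = ρ b then a else if ρ a = ρ c then c else b) = b := by
            simp [e1, e2]
          simp only [hkb]
          simp [hab, this]
  · push Not at h
    refine ⟨Function.update σ i (!σ w), fun j hj => by simp [hj], ?_, ?_⟩
    · exact ⟨i, w, by simp [hwi]⟩
    · exact h _ (fun j hj => by simp [hj]) ⟨i, w, by simp [hwi]⟩

lemma flip_two {n : ℕ} {a b c : Fin n} (hab : a ≠ b) (hac : a ≠ c) (hbc : b ≠ c)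
    (σ : Fin n → Bool) (i j : Fin n) (hij : i ≠ j) :
    ∃ ρ : Fin n → Bool, (∀ l, l ≠ i → l ≠ j → ρ l = σ l) ∧
      nonconst ρ ∧ kidx a b c ρ ≠ i ∧ kidx a b c ρ ≠ j := by
  by_cases hi : i = a ∨ i = b ∨ i = c
  · by_cases hj : j = a ∨ j = b ∨ j = c
    · have key : ∀ u v : Fin n, u ≠ v →
          (u = a ∧ v = b ∨ u = a ∧ v = c ∨ u = b ∧ v = c) →
          ∃ ρ : Fin n → Bool, (∀ l, l ≠ u → l ≠ v → ρ l = σ l) ∧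
            nonconst ρ ∧ kidx a b c ρ ≠ u ∧ kidx a b c ρ ≠ v := by
        rintro u v huv (⟨rfl, rfl⟩ | ⟨rfl, rfl⟩ | ⟨rfl, rfl⟩)
        · refine ⟨Function.update (Function.update σ u (σ c)) v (!σ c),
            fun l h1 h2 => by simp [h1, h2], ⟨u, v, by simp [hab]⟩, ?_⟩
          simp [kidx, hab, hac, hbc, hab.symm, hac.symm, hbc.symm]
        · refine ⟨Function.update (Function.update σ u (!σ b)) v (σ b),
            fun l h1 h2 => by simp [h1, h2], ⟨u, v, by simp [hac]⟩, ?_⟩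
          simp [kidx, hab, hac, hbc, hab.symm, hac.symm, hbc.symm]
        · refine ⟨Function.update (Function.update σ u (σ a)) v (!σ a),
            fun l h1 h2 => by simp [h1, h2], ⟨u, v, by simp [hbc]⟩, ?_⟩
          simp [kidx, hab, hac, hbc, hab.symm, hac.symm, hbc.symm]
      by_cases hc : (i = a ∧ j = b ∨ i = a ∧ j = c ∨ i = b ∧ j = c)
      · exact key i j hij hc
      · have hc' : (j = a ∧ i = b ∨ j = a ∧ i = c ∨ j = b ∧ i = c) := by grind
        obtain ⟨ρ, h1, h2, h3, h4⟩ := key j i hij.symm hc'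
        exact ⟨ρ, fun l h h' => h1 l h' h, h2, h4, h3⟩
    · obtain ⟨ρ, h1, h2, h3⟩ := flip_one hab hac hbc σ i
      refine ⟨ρ, fun l h _ => h1 l h, h2, h3, ?_⟩
      unfold kidx; split_ifs <;> grind
  · obtain ⟨ρ, h1, h2, h3⟩ := flip_one hab hac hbc σ j
    refine ⟨ρ, fun l _ h => h1 l h, h2, ?_, h3⟩
    unfold kidx; split_ifs <;> grind

lemma abs_dirv {n : ℕ} (a b c : Fin n) {δ ζ : ℝ} (hδ : 0 < δ) (hζ : 0 < ζ)
    (σ : Fin n → Bool) (i : Fin n) : |dirv a b c δ ζ σ i| = mag a b c δ ζ σ i := by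
  have : 0 ≤ mag a b c δ ζ σ i := by unfold mag; split_ifs <;> linarith
  unfold dirv
  split_ifs <;> simp [abs_of_nonneg this]

lemma mag_pos {n : ℕ} (a b c : Fin n) {δ ζ : ℝ} (hδ : 0 < δ) (hζ : 0 < ζ)
    (σ : Fin n → Bool) (i : Fin n) : 0 < mag a b c δ ζ σ i := by
  unfold mag; split_ifs <;> linarith

lemma mul_dirv_neg {n : ℕ} (a b c : Fin n) {δ ζ : ℝ} (hδ : 0 < δ) (hζ : 0 < ζ)
    (σ : Fin n → Bool) (x : Fin n → ℝ) (i : Fin n) (hx : x i ≠ 0)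
    (hσ : σ i = decide (x i < 0)) : x i * dirv a b c δ ζ σ i < 0 := by
  have := mag_pos a b c hδ hζ σ i
  unfold dirv
  rcases lt_or_gt_of_ne hx with h | h
  · simp only [hσ, h, decide_true, if_true]; nlinarith
  · simp only [hσ, not_lt.mpr h.le, decide_false]
    simp; positivity

/-- Points of `B` all have absolute coordinates at most one. -/
lemma abs_le_one_of_mem {n : ℕ} (hn : 4 ≤ n) {B : Set (Fin n → ℝ)} (hB : memU B)
    (hin : ∀ i j : Fin n, i ≠ j → allOnes - stdB i - stdB j ∈ B) {x : Fin n → ℝ}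
    (hx : x ∈ B) (i : Fin n) : |x i| ≤ 1 := by
  obtain ⟨⟨hc, -, -⟩, hu, hf⟩ := hB
  by_contra hlt
  push Not at hlt
  have hhalf : (fun _ => 1 / 2 : Fin n → ℝ) ∈ B := by
    have h1 := hin ⟨0, by omega⟩ ⟨1, by omega⟩ (by simp)
    have h2 := hin ⟨2, by omega⟩ ⟨3, by omega⟩ (by simp)
    have h3 := hc h1 h2 (show (0 : ℝ) ≤ 1 / 2 by norm_num) (show (0 : ℝ) ≤ 1 / 2 by norm_num)
      (by norm_num)
    refine solid_mem hc hu h3 (fun j => ?_)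
    refine le_trans (le_of_eq (abs_of_pos (by norm_num))) (le_trans ?_ (le_abs_self _))
    simp only [allOnes, Pi.add_apply, Pi.smul_apply, Pi.sub_apply, stdB_apply', smul_eq_mul,
      Fin.ext_iff]
    split_ifs <;> first | omega | norm_num
  set t := |x i| with ht
  have hxi : (fun j => if j = i then t else 0 : Fin n → ℝ) ∈ B := by
    refine solid_mem hc hu hx (fun j => ?_)
    by_cases h : j = i
    · subst h; simp [ht]
    · simp [h]
  have hs : 0 < (t - 1) / (2 * t) := by apply div_pos <;> linarith
  have hs1 : (t - 1) / (2 * t) ≤ 1 := by rw [div_le_one (by linarith)]; linarith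
  have hy := hc hxi hhalf (show 0 ≤ 1 - (t - 1) / (2 * t) by linarith) hs.le (by ring)
  have hint : stdB i ∈ interior B := by
    refine mem_int hc hu hy (fun j => ?_)
    simp only [Pi.add_apply, Pi.smul_apply, smul_eq_mul, stdB_apply']
    by_cases h : j = i
    · simp only [h, if_true, abs_one]
      have : (1 - (t - 1) / (2 * t)) * t = (t + 1) / 2 := by field_simp; ring
      rw [this]; linarith
    · simp only [h, if_false, abs_zero]; linarith
  exact (hf i).2 hint

lemma exists_eta {n : ℕ} {B : Set (Fin n → ℝ)} (hc : IsClosed B) (h1 : (allOnes : Fin n → ℝ) ∉ B) :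
    ∃ η : ℝ, 0 < η ∧ η < 1 ∧ (fun _ => 1 - η : Fin n → ℝ) ∉ B := by
  have hcont : Continuous (fun η : ℝ => (fun _ => 1 - η : Fin n → ℝ)) := by fun_prop
  have hopen := hc.isOpen_compl.preimage hcont
  have h0 : (0 : ℝ) ∈ (fun η : ℝ => (fun _ => 1 - η : Fin n → ℝ)) ⁻¹' Bᶜ := by
    simp only [Set.mem_preimage, sub_zero]
    exact h1
  obtain ⟨r, hr, hball⟩ := Metric.isOpen_iff.mp hopen 0 h0
  refine ⟨min (r / 2) (1 / 2), by positivity, by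
    exact lt_of_le_of_lt (min_le_right _ _) (by norm_num), ?_⟩
  have : min (r / 2) (1 / 2) ∈ Metric.ball (0 : ℝ) r := by
    rw [Metric.mem_ball, Real.dist_eq, sub_zero, abs_of_pos (by positivity)]
    exact lt_of_le_of_lt (min_le_left _ _) (by linarith)
  exact hball this

lemma exists_illum {n : ℕ} (hn : 4 ≤ n) {B : Set (Fin n → ℝ)} (hB : memU B)
    (hin : ∀ i j : Fin n, i ≠ j → allOnes - stdB i - stdB j ∈ B)
    {a b c : Fin n} (hab : a ≠ b) (hac : a ≠ c) (hbc : b ≠ c)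
    {η : ℝ} (hη : 0 < η) (hη1 : η < 1) (hηB : (fun _ => 1 - η : Fin n → ℝ) ∉ B)
    {x : Fin n → ℝ} (hx : x ∈ B) :
    ∃ σ : Fin n → Bool, nonconst σ ∧ Illuminates B (dirv a b c (1 / 4) (η / 8) σ) x := by
  have hle := fun i => abs_le_one_of_mem hn hB hin hx i
  obtain ⟨⟨hc, -, -⟩, hu, hf⟩ := hB
  have hδ : (0 : ℝ) < 1 / 4 := by norm_num
  have hζ : 0 < η / 8 := by positivity
  have habs := fun σ i => abs_dirv a b c hδ hζ σ i
  have hneg := fun σ i => mul_dirv_neg a b c hδ hζ σ x i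
  have hmp := fun σ i => mag_pos a b c hδ hζ σ i
  have hm1 : ∀ σ i, mag a b c (1 / 4) (η / 8) σ i ≤ 1 := by
    intro σ i; unfold mag; split_ifs <;> linarith
  have hmk : ∀ σ, mag a b c (1 / 4) (η / 8) σ (kidx a b c σ) = 1 := by
    intro σ; simp [mag]
  have hm4 : ∀ σ i, i ≠ kidx a b c σ → mag a b c (1 / 4) (η / 8) σ i ≤ 1 / 4 := by
    intro σ i hi; unfold mag; rw [if_neg hi]; split_ifs <;> linarith
  have hml : ∀ σ i, η / 8 ≤ mag a b c (1 / 4) (η / 8) σ i := by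
    intro σ i; unfold mag; split_ifs <;> linarith
  have hmnl : ∀ σ i, ¬ lone σ i → 1 / 4 ≤ mag a b c (1 / 4) (η / 8) σ i := by
    intro σ i hi; unfold mag; split_ifs <;> linarith
  set σ₀ : Fin n → Bool := fun i => decide (x i < 0) with hσ₀
  by_cases h3 : ∃ i j l : Fin n, i ≠ j ∧ i ≠ l ∧ j ≠ l ∧ x i = 0 ∧ x j = 0 ∧ x l = 0
  · -- three zeros
    obtain ⟨i, j, l, hij, hil, hjl, hi, hj, hl⟩ := h3
    refine ⟨Function.update σ₀ i (!σ₀ j), ⟨i, j, by simp [hij.symm]⟩, ?_⟩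
    have hz := conv3 hc (hin i j hij) (hin i l hil) (hin j l hjl)
      (show (0 : ℝ) ≤ 1 / 3 by norm_num) (show (0 : ℝ) ≤ 1 / 3 by norm_num)
      (show (0 : ℝ) ≤ 1 / 3 by norm_num) (by norm_num)
    refine illum_of hc hu (show (0 : ℝ) < 4 by norm_num) hx hz (fun m => ?_)
    rw [habs]
    simp only [allOnes, Pi.add_apply, Pi.smul_apply, Pi.sub_apply, stdB_apply', smul_eq_mul]
    have q1 := hm1 (Function.update σ₀ i (!σ₀ j)) m
    have q2 := hmp (Function.update σ₀ i (!σ₀ j)) m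
    by_cases hm : x m = 0
    · right
      rw [hm, abs_zero]
      split_ifs <;> first | (exfalso; grind) | linarith
    · left
      have hmi : m ≠ i := by rintro rfl; exact hm hi
      have hmj : m ≠ j := by rintro rfl; exact hm hj
      have hml : m ≠ l := by rintro rfl; exact hm hl
      refine ⟨hneg _ m hm (by simp [hmi, hσ₀]), ?_⟩
      simp only [hmi, hmj, hml, if_false]
      linarith [hle m]
  by_cases h2 : ∃ i j : Fin n, i ≠ j ∧ x i = 0 ∧ x j = 0
  · obtain ⟨i, j, hij, hi, hj⟩ := h2
    obtain ⟨ρ, hρ, hnc, hki, hkj⟩ := flip_two hab hac hbc σ₀ i j hij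
    refine ⟨ρ, hnc, ?_⟩
    have hz := hc (hin _ i hki) (hin _ j hkj)
      (show (0 : ℝ) ≤ 1 / 2 by norm_num) (show (0 : ℝ) ≤ 1 / 2 by norm_num) (by norm_num)
    refine illum_of hc hu (show (0 : ℝ) < 3 / 4 by norm_num) hx hz (fun m => ?_)
    rw [habs]
    simp only [allOnes, Pi.add_apply, Pi.smul_apply, Pi.sub_apply, stdB_apply', smul_eq_mul]
    have q1 := hm4 ρ m
    have q2 := hmp ρ m
    have q3 := hle m
    by_cases hm : x m = 0
    · right
      have hm' : m = i ∨ m = j := by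
        by_contra hcon
        push Not at hcon
        exact h3 ⟨i, j, m, hij, hcon.1.symm, hcon.2.symm, hi, hj, hm⟩
      have hmk' : m ≠ kidx a b c ρ := by rcases hm' with rfl | rfl <;> exact Ne.symm ‹_›
      have q4 := q1 hmk'
      rw [hm, abs_zero]
      rcases hm' with rfl | rfl
      · simp only [hmk', hij, if_true, if_false]; linarith
      · simp only [hmk', hij.symm, if_true, if_false]; linarith
    · left
      have hmi : m ≠ i := by rintro rfl; exact hm hi
      have hmj : m ≠ j := by rintro rfl; exact hm hj
      refine ⟨hneg _ m hm (by simp [hmi, hmj, hσ₀, hρ]), ?_⟩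
      simp only [hmi, hmj, if_false]
      by_cases hmk' : m = kidx a b c ρ
      · have := hmk ρ
        rw [← hmk'] at this
        rw [this]; simp only [hmk', if_true]; rw [← hmk']; linarith
      · simp only [hmk', if_false]; linarith
  by_cases h1 : ∃ i : Fin n, x i = 0
  · obtain ⟨i, hi⟩ := h1
    obtain ⟨ρ, hρ, hnc, hki⟩ := flip_one hab hac hbc σ₀ i
    refine ⟨ρ, hnc, ?_⟩
    -- two further indices
    obtain ⟨j, l, hjl, hji, hjk, hli, hlk, hlj⟩ : ∃ j l : Fin n, j ≠ l ∧ j ≠ i ∧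
        j ≠ kidx a b c ρ ∧ l ≠ i ∧ l ≠ kidx a b c ρ ∧ ¬ lone ρ j := by
      have hcard : 1 < (Finset.univ \ {i, kidx a b c ρ} : Finset (Fin n)).card := by
        have e1 := Finset.le_card_sdiff ({i, kidx a b c ρ} : Finset (Fin n)) Finset.univ
        have e2 := Finset.card_le_two (a := i) (b := kidx a b c ρ)
        rw [Finset.card_univ, Fintype.card_fin] at e1
        omega
      obtain ⟨j, hj, l, hl, hjl⟩ := Finset.one_lt_card.mp hcard
      simp only [Finset.mem_sdiff, Finset.mem_univ, true_and, Finset.mem_insert,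
        Finset.mem_singleton, not_or] at hj hl
      by_cases hlo : lone ρ j
      · exact ⟨l, j, hjl.symm, hl.1, hl.2, hj.1, hj.2, fun h => hjl (lone_unique hn hlo h)⟩
      · exact ⟨j, l, hjl, hj.1, hj.2, hl.1, hl.2, hlo⟩
    have hz := conv3 hc (hin _ i hki) (hin _ j hjk.symm) (hin _ l hlk.symm)
      (show (0 : ℝ) ≤ 1 / 2 - η / 16 by linarith) (show (0 : ℝ) ≤ 1 / 2 - η / 16 by linarith)
      (show (0 : ℝ) ≤ η / 8 by linarith) (by ring)
    refine illum_of hc hu (show (0 : ℝ) < 1 / 2 by norm_num) hx hz (fun m => ?_)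
    rw [habs]
    simp only [allOnes, Pi.add_apply, Pi.smul_apply, Pi.sub_apply, stdB_apply', smul_eq_mul]
    have q1 := hm4 ρ m
    have q2 := hmp ρ m
    have q3 := hle m
    by_cases hm : x m = 0
    · right
      have hm' : m = i := by
        by_contra hcon
        exact h2 ⟨i, m, fun h => hcon h.symm, hi, hm⟩
      subst hm'
      have q4 := q1 hki.symm
      rw [hm, abs_zero]
      simp only [hki.symm, hji.symm, hli.symm, if_true, if_false]; linarith
    · left
      have hmi : m ≠ i := by rintro rfl; exact hm hi
      refine ⟨hneg _ m hm (by simp [hmi, hσ₀, hρ]), ?_⟩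
      simp only [hmi, if_false]
      by_cases hmk' : m = kidx a b c ρ
      · have := hmk ρ
        have hmj : m ≠ j := fun h => hjk (h ▸ hmk')
        have hml' : m ≠ l := fun h => hlk (h ▸ hmk')
        rw [← hmk'] at this
        rw [this, if_pos hmk', if_neg hmj, if_neg hml']; linarith
      · simp only [hmk', if_false]
        by_cases hmj : m = j
        · subst hmj
          have := hmnl ρ m hlj
          simp only [hjl, if_true, if_false]; linarith
        · simp only [hmj, if_false]
          by_cases hml' : m = l
          · have := hml ρ m
            simp only [hml', if_true]; rw [← hml']; linarith
          · simp only [hml', if_false]; linarith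
  push Not at h1
  by_cases hnc : nonconst σ₀
  · refine ⟨σ₀, hnc, ?_⟩
    have h0 : (0 : Fin n → ℝ) ∈ B := solid_mem hc hu hx (fun i => by simp)
    refine illum_of hc hu (show (0 : ℝ) < η / 16 by positivity) hx h0 (fun m => ?_)
    left
    refine ⟨hneg _ m (h1 m) (by simp [hσ₀]), ?_⟩
    rw [habs]
    have := hml σ₀ m
    have := hle m
    simp only [Pi.zero_apply, sub_zero]
    nlinarith
  · obtain ⟨i, hi⟩ : ∃ i, |x i| < 1 - η := by
      by_contra hcon
      push Not at hcon
      refine hηB (solid_mem hc hu hx (fun i => ?_))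
      rw [abs_of_pos (by linarith)]
      exact hcon i
    unfold nonconst at hnc
    push Not at hnc
    set ρ : Fin n → Bool := Function.update σ₀ i (!σ₀ i) with hρ
    have hlone : lone ρ i := by
      intro j hj
      simp [hρ, hj, hnc j i]
    have hik : i ≠ kidx a b c ρ := by
      intro h
      obtain ⟨j, hj, hj'⟩ := kidx_not_lone hab hac hbc ρ
      rw [← h] at hj hj'
      exact hlone j hj hj'
    obtain ⟨j, hj⟩ : ∃ j, j ≠ i := ⟨_, hik.symm⟩
    obtain ⟨l, hl⟩ : ∃ l, l ∉ ({i, j} : Finset (Fin n)) := by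
      by_contra hcon
      push Not at hcon
      have h1 : (Finset.univ : Finset (Fin n)) ⊆ {i, j} := fun l _ => hcon l
      have h2 := Finset.card_le_card h1
      have h3 := Finset.card_le_two (a := i) (b := j)
      rw [Finset.card_univ, Fintype.card_fin] at h2
      omega
    simp only [Finset.mem_insert, Finset.mem_singleton, not_or] at hl
    have hz : stdB i ∈ B := by
      refine solid_mem hc hu (hin j l (Ne.symm hl.2)) (fun m => ?_)
      by_cases hm : m = i
      · subst hm
        simp [allOnes, stdB_apply', hj.symm, Ne.symm hl.1]
      · simp [stdB_apply', hm]
    refine ⟨ρ, ⟨j, i, hlone j hj⟩, illum_of hc hu (show (0 : ℝ) < 3 / 16 by norm_num) hx hz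
      (fun m => ?_)⟩
    rw [habs, stdB_apply']
    by_cases hm : m = i
    · right
      rw [hm]
      simp only [if_true, mag, if_neg hik, if_pos hlone]
      linarith
    · left
      refine ⟨hneg _ m (h1 m) (by simp [hσ₀, hρ, hm]), ?_⟩
      have := hmnl ρ m (fun h => hm (lone_unique hn h hlone))
      have := hle m
      rw [if_neg hm]; linarith

/-- If `B ∈ 𝒰^n`, `n ≥ 4`, contains every coordinate permutation
of `e_1 + ⋯ + e_{n-2}` (i.e. `𝟙 - e_i - e_j` for all `i ≠ j`) but no coordinate
permutation of `e_1 + ⋯ + e_{n-1}` (i.e. no `𝟙 - e_i`), then there are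
`0 < ζ < δ < 1` and a symmetric illuminating set of at most `2^n - 2` directions,
each with exactly one coordinate `±1` at one of the last three indices, all other
coordinates of absolute value `δ` or `ζ`, and at most one coordinate of absolute
value `ζ`; in particular `𝕀(B) ≤ 2^n - 2`. -/
theorem stmt15 (n : ℕ) (hn : 4 ≤ n) (B : Set (Fin n → ℝ)) (hB : memU B)
    (hin : ∀ i j : Fin n, i ≠ j → allOnes - stdB i - stdB j ∈ B)
    (hout : ∀ i : Fin n, allOnes - stdB i ∉ B) :
    ∃ δ ζ : ℝ, 0 < ζ ∧ ζ < δ ∧ δ < 1 ∧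
      ∃ D : Finset (Fin n → ℝ), (∀ d ∈ D, -d ∈ D) ∧ D.card ≤ 2 ^ n - 2 ∧
        (∀ d ∈ D, ∃ i : Fin n,
          (i.val = n - 3 ∨ i.val = n - 2 ∨ i.val = n - 1) ∧
          (d i = 1 ∨ d i = -1) ∧
          (∀ j, j ≠ i → |d j| = δ ∨ |d j| = ζ) ∧
          ({j : Fin n | |d j| = ζ}).ncard ≤ 1) ∧
        IlluminatesSet B ↑D ∧ illumNumber B ≤ 2 ^ n - 2 := by
  obtain ⟨hc, hcomp, -⟩ := hB.1
  have hu := hB.2.1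
  have hones : (allOnes : Fin n → ℝ) ∉ B := by
    intro h
    refine hout ⟨0, by omega⟩ (solid_mem hc hu h (fun j => ?_))
    simp only [allOnes, Pi.sub_apply, stdB_apply']
    split_ifs <;> norm_num
  obtain ⟨η, hη, hη1, hηB⟩ := exists_eta hcomp.isClosed hones
  obtain ⟨a, ha⟩ : ∃ a : Fin n, a.val = n - 3 := ⟨⟨n - 3, by omega⟩, rfl⟩
  obtain ⟨b, hb⟩ : ∃ b : Fin n, b.val = n - 2 := ⟨⟨n - 2, by omega⟩, rfl⟩
  obtain ⟨c, hc'⟩ : ∃ c : Fin n, c.val = n - 1 := ⟨⟨n - 1, by omega⟩, rfl⟩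
  have hab : a ≠ b := by rw [Ne, Fin.ext_iff]; omega
  have hac : a ≠ c := by rw [Ne, Fin.ext_iff]; omega
  have hbc : b ≠ c := by rw [Ne, Fin.ext_iff]; omega
  have hδ : (0 : ℝ) < 1 / 4 := by norm_num
  have hζ : 0 < η / 8 := by positivity
  classical
  let D : Finset (Fin n → ℝ) :=
    (Finset.univ.filter (fun σ : Fin n → Bool => nonconst σ)).image (dirv a b c (1 / 4) (η / 8))
  have hmemD : ∀ d, d ∈ D ↔ ∃ σ, nonconst σ ∧ dirv a b c (1 / 4) (η / 8) σ = d := by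
    intro d; simp [D]
  have hcard : D.card ≤ 2 ^ n - 2 := by
    refine Finset.card_image_le.trans ?_
    have hsub : (Finset.univ.filter (fun σ : Fin n → Bool => nonconst σ)) ⊆
        Finset.univ \ {fun _ => true, fun _ => false} := by
      intro σ hσ
      obtain ⟨p, q, hpq⟩ := (Finset.mem_filter.mp hσ).2
      simp only [Finset.mem_sdiff, Finset.mem_univ, true_and, Finset.mem_insert,
        Finset.mem_singleton, not_or]
      constructor <;> rintro rfl <;> exact hpq rfl
    refine (Finset.card_le_card hsub).trans ?_
    rw [Finset.card_sdiff_of_subset (Finset.subset_univ _), Finset.card_pair, Finset.card_univ]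
    · simp
    · intro h
      have := congrFun h a
      simp at this
  have hill : IlluminatesSet B ↑D := by
    intro x hx
    have hxB : x ∈ B := hcomp.isClosed.frontier_subset hx
    obtain ⟨σ, h1, h2⟩ := exists_illum hn hB hin hab hac hbc hη hη1 hηB hxB
    exact ⟨_, (hmemD _).mpr ⟨σ, h1, rfl⟩, h2⟩
  have hk1 : ∀ σ, dirv a b c (1 / 4) (η / 8) σ (kidx a b c σ) = 1 ∨
      dirv a b c (1 / 4) (η / 8) σ (kidx a b c σ) = -1 := by
    intro σ
    simp only [dirv, mag, if_true]
    split_ifs <;> simp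
  refine ⟨1 / 4, η / 8, hζ, by linarith, by norm_num, D, ?_, hcard, ?_, hill, ?_⟩
  · intro d hd
    obtain ⟨σ, ⟨p, q, hpq⟩, rfl⟩ := (hmemD d).mp hd
    refine (hmemD _).mpr ⟨fun i => !σ i, ⟨p, q, by simpa using hpq⟩, ?_⟩
    funext i
    have hl : lone (fun i => !σ i) i ↔ lone σ i := by simp [lone]
    have hk : kidx a b c (fun i => !σ i) = kidx a b c σ := by simp [kidx]
    have hm : mag a b c (1 / 4) (η / 8) (fun i => !σ i) i = mag a b c (1 / 4) (η / 8) σ i := by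
      simp only [mag, hl, hk]
    rw [Pi.neg_apply]
    unfold dirv
    rw [hm]
    rcases Bool.eq_false_or_eq_true (σ i) with h | h <;> simp [h]
  · intro d hd
    obtain ⟨σ, hσ, rfl⟩ := (hmemD d).mp hd
    refine ⟨kidx a b c σ, ?_, hk1 σ, ?_, ?_⟩
    · unfold kidx; split_ifs <;> omega
    · intro j hj
      rw [abs_dirv a b c hδ hζ]
      unfold mag
      rw [if_neg hj]
      split_ifs
      · exact Or.inr rfl
      · exact Or.inl rfl
    · rw [Set.ncard_le_one_iff]
      have key : ∀ j, |dirv a b c (1 / 4) (η / 8) σ j| = η / 8 → lone σ j := by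
        intro j hj
        rw [abs_dirv a b c hδ hζ] at hj
        unfold mag at hj
        split_ifs at hj with h1 h2
        · linarith
        · exact h2
        · linarith
      intro i j hi hj
      exact lone_unique hn (key i hi) (key j hj)
  · refine (Nat.sInf_le ?_).trans hcard
    refine ⟨D, rfl, ?_, hill⟩
    intro d hd h0
    obtain ⟨σ, hσ, rfl⟩ := (hmemD d).mp hd
    have := hk1 σ
    rw [h0] at this
    simp at this
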